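/- arXiv:0801.1792 — 6 statements merged into one kernel-verified Lean document; each statement's English description precedes it below -/
import Mathlib

section
/- Fix κ > 0 and t ≤ (4+κ)²/(8κ), and let γ = (4+κ − √((4+κ)² − 8tκ))/(2κ) and β = t − (4+κ)γ/2. Then the function F(x,y) = y^β · (x²+y²)^γ, defined for real x and y > 0, satisfies at every point (x,y) with y > 0 the partial differential equation 2t·(x²−y²)/(x²+y²)²·F − (2x/(x²+y²))·∂F/∂x + (2y/(x²+y²))·∂F/∂y + (κ/2)·∂²F/∂x² = 0. -/
/-- The `x`-derivative of `x ↦ c (x² + y²)^a` away from the real axis. -/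
lemma hasDerivAt_const_mul_sq_add_sq_rpow (a c x : ℝ) {y : ℝ} (hy : 0 < y) :
    HasDerivAt (fun u : ℝ => c * (u ^ 2 + y ^ 2) ^ a)
      (2 * a * x / (x ^ 2 + y ^ 2) * (c * (x ^ 2 + y ^ 2) ^ a)) x := by
  have hr : 0 < x ^ 2 + y ^ 2 := by positivity
  have h := ((((hasDerivAt_id x).pow 2).add_const (y ^ 2)).rpow_const (p := a)
    (Or.inl hr.ne')).const_mul c
  refine h.congr_deriv ?_
  simp only [Pi.pow_apply, id_eq, Real.rpow_sub_one hr.ne']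
  field_simp
  norm_num
  ring

/-- The `y`-derivative of `y ↦ y^b (x² + y²)^a` for `y > 0`. -/
lemma hasDerivAt_rpow_mul_sq_add_sq_rpow (a b x : ℝ) {y : ℝ} (hy : 0 < y) :
    HasDerivAt (fun v : ℝ => v ^ b * (x ^ 2 + v ^ 2) ^ a)
      ((b / y + 2 * a * y / (x ^ 2 + y ^ 2)) * (y ^ b * (x ^ 2 + y ^ 2) ^ a)) y := by
  have hr : 0 < x ^ 2 + y ^ 2 := by positivity
  have h := (Real.hasDerivAt_rpow_const (p := b) (Or.inl hy.ne')).mul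
    ((((hasDerivAt_id y).pow 2).const_add (x ^ 2)).rpow_const (p := a) (Or.inl hr.ne'))
  refine h.congr_deriv ?_
  simp only [Pi.pow_apply, id_eq, Real.rpow_sub_one hr.ne', Real.rpow_sub_one hy.ne']
  field_simp
  norm_num
  ring

/-- The second `x`-derivative of `x ↦ c (x² + y²)^a` away from the real axis. -/
lemma deriv_deriv_const_mul_sq_add_sq_rpow (a c x : ℝ) {y : ℝ} (hy : 0 < y) :
    deriv (deriv fun u : ℝ => c * (u ^ 2 + y ^ 2) ^ a) x =
      (2 * a / (x ^ 2 + y ^ 2) + 4 * a * (a - 1) * x ^ 2 / (x ^ 2 + y ^ 2) ^ 2) *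
        (c * (x ^ 2 + y ^ 2) ^ a) := by
  have hr : 0 < x ^ 2 + y ^ 2 := by positivity
  rw [funext fun u => (hasDerivAt_const_mul_sq_add_sq_rpow a c u hy).deriv]
  have hq := ((hasDerivAt_id x).const_mul (2 * a)).div
    (((hasDerivAt_id x).pow 2).add_const (y ^ 2)) hr.ne'
  refine ((hq.mul (hasDerivAt_const_mul_sq_add_sq_rpow a c x hy)).congr_deriv ?_).deriv
  simp only [Pi.pow_apply, Pi.div_apply, id_eq]
  field_simp
  norm_num
  ring

/-- The exponent `γ` is a root of `κ γ² − (4 + κ) γ + 2 t`. -/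
lemma sle_exponent_quadratic {κ t γ : ℝ} (hκ : 0 < κ) (ht : t ≤ (4 + κ) ^ 2 / (8 * κ))
    (hγ : γ = (4 + κ - Real.sqrt ((4 + κ) ^ 2 - 8 * t * κ)) / (2 * κ)) :
    κ * γ ^ 2 - (4 + κ) * γ + 2 * t = 0 := by
  rw [le_div_iff₀ (by positivity)] at ht
  have hs := Real.sq_sqrt (show 0 ≤ (4 + κ) ^ 2 - 8 * t * κ by linarith)
  rw [hγ]
  generalize Real.sqrt ((4 + κ) ^ 2 - 8 * t * κ) = s at hs ⊢
  field_simp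
  linear_combination hs

/-- the chordal-SLE drift PDE is satisfied by
`F(x,y) = y^β (x²+y²)^γ` on the upper half-plane, where
`γ = (4+κ − √((4+κ)² − 8tκ))/(2κ)` and `β = t − (4+κ)γ/2`. -/
theorem sle_chordal_pde (κ t γ β : ℝ) (hκ : 0 < κ)
    (ht : t ≤ (4 + κ) ^ 2 / (8 * κ))
    (hγ : γ = (4 + κ - Real.sqrt ((4 + κ) ^ 2 - 8 * t * κ)) / (2 * κ))
    (hβ : β = t - (4 + κ) * γ / 2)
    (F : ℝ → ℝ → ℝ)
    (hF : ∀ x y : ℝ, F x y = y ^ β * (x ^ 2 + y ^ 2) ^ γ) :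
    ∀ x y : ℝ, 0 < y →
      2 * t * ((x ^ 2 - y ^ 2) / (x ^ 2 + y ^ 2) ^ 2) * F x y
        - (2 * x / (x ^ 2 + y ^ 2)) * deriv (fun x' => F x' y) x
        + (2 * y / (x ^ 2 + y ^ 2)) * deriv (fun y' => F x y') y
        + (κ / 2) * deriv (deriv (fun x' => F x' y)) x = 0 := by
  intro x y hy
  have hr : 0 < x ^ 2 + y ^ 2 := by positivity
  have hquad := sle_exponent_quadratic hκ ht hγ
  simp only [hF]
  rw [(hasDerivAt_const_mul_sq_add_sq_rpow γ (y ^ β) x hy).deriv,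
    (hasDerivAt_rpow_mul_sq_add_sq_rpow γ β x hy).deriv,
    deriv_deriv_const_mul_sq_add_sq_rpow γ (y ^ β) x hy]
  generalize y ^ β * (x ^ 2 + y ^ 2) ^ γ = f
  have hcoeff : 2 * t * ((x ^ 2 - y ^ 2) / (x ^ 2 + y ^ 2) ^ 2)
      - 2 * x / (x ^ 2 + y ^ 2) * (2 * γ * x / (x ^ 2 + y ^ 2))
      + 2 * y / (x ^ 2 + y ^ 2) * (β / y + 2 * γ * y / (x ^ 2 + y ^ 2))
      + κ / 2 * (2 * γ / (x ^ 2 + y ^ 2)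
        + 4 * γ * (γ - 1) * x ^ 2 / (x ^ 2 + y ^ 2) ^ 2) = 0 := by
    rw [hβ]
    field_simp
    linear_combination 4 * x ^ 2 * hquad
  linear_combination f * hcoeff
end

section
/- Let γ ∈ ℝ with γ ≠ −1/2, and for r > 1 set I(r) = ∫₀^{2π} (r² − 2r·cos θ + 1)^γ dθ. Then there exist constants 0 < c ≤ C and r₀ ∈ (1,2) such that for all r ∈ (1, r₀): if γ > −1/2 then c ≤ I(r) ≤ C, and if γ < −1/2 then c·(r−1)^{2γ+1} ≤ I(r) ≤ C·(r−1)^{2γ+1}. -/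
open intervalIntegral

section CircleWeight

open Real MeasureTheory

variable {γ r θ : ℝ}

lemma sq_sub_one_le_circle_weight (hr : 1 < r) (θ : ℝ) :
    (r - 1) ^ 2 ≤ r ^ 2 - 2 * r * cos θ + 1 := by
  nlinarith [cos_le_one θ]

lemma circle_weight_pos (hr : 1 < r) (θ : ℝ) : 0 < r ^ 2 - 2 * r * cos θ + 1 :=
  (pow_pos (sub_pos.2 hr) 2).trans_le (sq_sub_one_le_circle_weight hr θ)

lemma mul_sq_le_circle_weight (hr : 1 < r) (h0 : 0 ≤ θ) (hπ : θ ≤ π) :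
    2 / π ^ 2 * θ ^ 2 ≤ r ^ 2 - 2 * r * cos θ + 1 := by
  have h := cos_le_one_sub_mul_cos_sq (abs_le.2 ⟨by linarith [pi_pos], hπ⟩)
  have hc : 0 ≤ 2 / π ^ 2 * θ ^ 2 := by positivity
  nlinarith [sq_nonneg (r - 1)]

lemma circle_weight_le_sq_add (hr : 1 < r) (θ : ℝ) :
    r ^ 2 - 2 * r * cos θ + 1 ≤ (r - 1) ^ 2 + r * θ ^ 2 := by
  nlinarith [one_sub_sq_div_two_le_cos (x := θ)]

lemma circle_weight_le_nine (hr : 1 < r) (hr₂ : r < 3 / 2) (θ : ℝ) :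
    r ^ 2 - 2 * r * cos θ + 1 ≤ 9 := by
  nlinarith [neg_one_le_cos θ]

lemma continuous_circle_weight_rpow (γ : ℝ) (hr : 1 < r) :
    Continuous fun θ : ℝ ↦ (r ^ 2 - 2 * r * cos θ + 1) ^ γ :=
  Continuous.rpow_const (by fun_prop) fun θ ↦ .inl (ne_of_gt (circle_weight_pos hr θ))

/-- The weight is symmetric about `θ = π`. -/
lemma integral_circle_weight_eq_two_mul (γ : ℝ) (hr : 1 < r) :
    ∫ θ in (0 : ℝ)..(2 * π), (r ^ 2 - 2 * r * cos θ + 1) ^ γ =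
      2 * ∫ θ in (0 : ℝ)..π, (r ^ 2 - 2 * r * cos θ + 1) ^ γ := by
  have hc := continuous_circle_weight_rpow γ hr
  have h := integral_comp_sub_left (a := 0) (b := π)
    (fun θ : ℝ ↦ (r ^ 2 - 2 * r * cos θ + 1) ^ γ) (2 * π)
  simp only [cos_two_pi_sub, sub_zero] at h
  rw [show 2 * π - π = π by ring] at h
  rw [← integral_add_adjacent_intervals (hc.intervalIntegrable 0 π)
    (hc.intervalIntegrable π (2 * π)), ← h, ← two_mul]

lemma integral_circle_weight_mono_interval (γ : ℝ) (hr : 1 < r) {a b : ℝ} (ha : 0 ≤ a)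
    (hab : a ≤ b) (hb : b ≤ π) :
    ∫ θ in a..b, (r ^ 2 - 2 * r * cos θ + 1) ^ γ ≤
      ∫ θ in (0 : ℝ)..π, (r ^ 2 - 2 * r * cos θ + 1) ^ γ :=
  integral_mono_interval ha hab hb
    (.of_forall fun θ ↦ rpow_nonneg (circle_weight_pos hr θ).le γ)
    ((continuous_circle_weight_rpow γ hr).intervalIntegrable 0 π)

lemma circle_weight_rpow_le_of_neg (hr : 1 < r) (hγ : γ < 0) (h0 : 0 < θ) (hπ : θ ≤ π) :
    (r ^ 2 - 2 * r * cos θ + 1) ^ γ ≤ (2 / π ^ 2) ^ γ * θ ^ (2 * γ) := by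
  calc (r ^ 2 - 2 * r * cos θ + 1) ^ γ ≤ (2 / π ^ 2 * θ ^ 2) ^ γ :=
        rpow_le_rpow_of_nonpos (by positivity) (mul_sq_le_circle_weight hr h0.le hπ) hγ.le
    _ = (2 / π ^ 2) ^ γ * θ ^ (2 * γ) := by
        rw [mul_rpow (by positivity) (by positivity), rpow_mul h0.le, rpow_two]

lemma min_mul_le_integral_circle_weight (γ : ℝ) (hr : 1 < r) (hr₂ : r < 3 / 2) :
    π / 2 * min 1 (9 ^ γ) ≤ ∫ θ in (0 : ℝ)..π, (r ^ 2 - 2 * r * cos θ + 1) ^ γ := by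
  have hπ := pi_pos
  refine le_trans ?_ (integral_circle_weight_mono_interval γ hr (a := π / 2) (b := π)
    (by linarith) (by linarith) le_rfl)
  have h := integral_mono_on (a := π / 2) (b := π) (by linarith)
    (_root_.intervalIntegrable_const (μ := volume) (c := min 1 ((9 : ℝ) ^ γ)))
    ((continuous_circle_weight_rpow γ hr).intervalIntegrable _ _) fun θ hθ ↦ by
      have hcos : cos θ ≤ 0 := cos_nonpos_of_pi_div_two_le_of_le hθ.1 (by linarith [hθ.2])
      have h1 : 1 ≤ r ^ 2 - 2 * r * cos θ + 1 := by nlinarith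
      rcases le_total 0 γ with h | h
      · exact (min_le_left _ _).trans (one_le_rpow h1 h)
      · exact (min_le_right _ _).trans
          (rpow_le_rpow_of_nonpos (by linarith) (circle_weight_le_nine hr hr₂ θ) h)
  rw [intervalIntegral.integral_const, smul_eq_mul, show π - π / 2 = π / 2 by ring] at h
  exact h

lemma exists_integral_circle_weight_le (hγ : -(1 / 2) < γ) :
    ∃ C : ℝ, ∀ r : ℝ, 1 < r → r < 3 / 2 →
      ∫ θ in (0 : ℝ)..π, (r ^ 2 - 2 * r * cos θ + 1) ^ γ ≤ C := by
  have hπ := pi_pos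
  rcases le_or_gt 0 γ with h | h
  · refine ⟨∫ _ in (0 : ℝ)..π, (9 : ℝ) ^ γ, fun r hr hr₂ ↦ ?_⟩
    exact integral_mono_on hπ.le ((continuous_circle_weight_rpow γ hr).intervalIntegrable _ _)
      _root_.intervalIntegrable_const fun θ _ ↦
        rpow_le_rpow (circle_weight_pos hr θ).le (circle_weight_le_nine hr hr₂ θ) h
  · refine ⟨∫ θ in (0 : ℝ)..π, (2 / π ^ 2) ^ γ * θ ^ (2 * γ), fun r hr hr₂ ↦ ?_⟩
    exact integral_mono_on_of_le_Ioo hπ.le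
      ((continuous_circle_weight_rpow γ hr).intervalIntegrable _ _)
      ((intervalIntegrable_rpow' (by linarith)).const_mul _) fun θ hθ ↦
        circle_weight_rpow_le_of_neg hr h hθ.1 hθ.2.le

lemma rpow_sq_mul_self {x : ℝ} (hx : 0 < x) (γ : ℝ) : x * (x ^ 2) ^ γ = x ^ (2 * γ + 1) := by
  rw [rpow_add_one hx.ne', rpow_mul hx.le, rpow_two, mul_comm]

lemma mul_rpow_le_integral_circle_weight (hγ : γ < 0) (hr : 1 < r) (hr₂ : r < 3 / 2) :
    4 ^ γ * (r - 1) ^ (2 * γ + 1) ≤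
      ∫ θ in (0 : ℝ)..π, (r ^ 2 - 2 * r * cos θ + 1) ^ γ := by
  have hε : 0 < r - 1 := sub_pos.2 hr
  refine le_trans ?_ (integral_circle_weight_mono_interval γ hr (b := r - 1) le_rfl hε.le
    (by linarith [pi_gt_three]))
  have h := integral_mono_on (a := 0) (b := r - 1) hε.le
    (_root_.intervalIntegrable_const (μ := volume) (c := (4 * (r - 1) ^ 2) ^ γ))
    ((continuous_circle_weight_rpow γ hr).intervalIntegrable _ _) fun θ hθ ↦ by
      have hsq : θ ^ 2 ≤ (r - 1) ^ 2 := pow_le_pow_left₀ hθ.1 hθ.2 2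
      refine rpow_le_rpow_of_nonpos (circle_weight_pos hr θ) ?_ hγ.le
      nlinarith [circle_weight_le_sq_add hr θ, sq_nonneg θ]
  rw [intervalIntegral.integral_const, smul_eq_mul, sub_zero,
    mul_rpow (by norm_num) (by positivity), mul_left_comm, rpow_sq_mul_self hε] at h
  exact h

lemma integral_circle_weight_le_mul_rpow (hγ : γ < -(1 / 2)) (hr : 1 < r) (hr₂ : r < 3 / 2) :
    ∫ θ in (0 : ℝ)..π, (r ^ 2 - 2 * r * cos θ + 1) ^ γ ≤
      (1 + (2 / π ^ 2) ^ γ / -(2 * γ + 1)) * (r - 1) ^ (2 * γ + 1) := by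
  have hε : 0 < r - 1 := sub_pos.2 hr
  have hεπ : r - 1 ≤ π := by linarith [pi_gt_three]
  have hc := continuous_circle_weight_rpow γ hr
  have hnear : ∫ θ in (0 : ℝ)..(r - 1), (r ^ 2 - 2 * r * cos θ + 1) ^ γ ≤
      (r - 1) ^ (2 * γ + 1) := by
    have h := integral_mono_on (a := 0) (b := r - 1) hε.le (hc.intervalIntegrable _ _)
      (_root_.intervalIntegrable_const (μ := volume) (c := ((r - 1) ^ 2) ^ γ)) fun θ _ ↦
        rpow_le_rpow_of_nonpos (by positivity) (sq_sub_one_le_circle_weight hr θ) (by linarith)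
    rwa [intervalIntegral.integral_const, smul_eq_mul, sub_zero, rpow_sq_mul_self hε] at h
  have h0 : (0 : ℝ) ∉ Set.uIcc (r - 1) π := by
    rw [Set.uIcc_of_le hεπ]
    exact fun h ↦ hε.not_ge h.1
  have hfar : ∫ θ in (r - 1)..π, (r ^ 2 - 2 * r * cos θ + 1) ^ γ ≤
      (2 / π ^ 2) ^ γ / -(2 * γ + 1) * (r - 1) ^ (2 * γ + 1) := by
    have h := integral_mono_on (μ := volume) (a := r - 1) (b := π) hεπ (hc.intervalIntegrable _ _)
      ((intervalIntegrable_rpow (r := 2 * γ) (.inr h0)).const_mul ((2 / π ^ 2) ^ γ)) fun θ hθ ↦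
        circle_weight_rpow_le_of_neg hr (by linarith) (hε.trans_le hθ.1) hθ.2
    rw [intervalIntegral.integral_const_mul,
      integral_rpow (.inr ⟨by linarith, h0⟩)] at h
    refine h.trans ?_
    rw [div_mul_eq_mul_div, mul_div_assoc, ← neg_div_neg_eq (_ - _)]
    have hpos : 0 < -(2 * γ + 1) := by linarith
    have hpi : 0 < π ^ (2 * γ + 1) := by positivity
    gcongr
    linarith
  rw [← integral_add_adjacent_intervals (hc.intervalIntegrable 0 (r - 1))
    (hc.intervalIntegrable (r - 1) π), add_mul, one_mul]
  exact add_le_add hnear hfar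

end CircleWeight

/-- two-sided asymptotics, as `r → 1⁺`, of
`I(r) = ∫₀^{2π} (r² − 2r cos θ + 1)^γ dθ`: for `γ > −1/2` the integral
is bounded between positive constants, while for `γ < −1/2` it is
comparable to `(r−1)^{2γ+1}`. -/
theorem circle_weight_integral_asymptotics (γ : ℝ) (hγ : γ ≠ -(1 / 2)) :
    ∃ c C r₀ : ℝ, 0 < c ∧ c ≤ C ∧ 1 < r₀ ∧ r₀ < 2 ∧
      ∀ r : ℝ, 1 < r → r < r₀ →
        (-(1 / 2) < γ →
          c ≤ (∫ θ in (0 : ℝ)..(2 * Real.pi),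
                (r ^ 2 - 2 * r * Real.cos θ + 1) ^ γ) ∧
          (∫ θ in (0 : ℝ)..(2 * Real.pi),
                (r ^ 2 - 2 * r * Real.cos θ + 1) ^ γ) ≤ C) ∧
        (γ < -(1 / 2) →
          c * (r - 1) ^ (2 * γ + 1) ≤
            (∫ θ in (0 : ℝ)..(2 * Real.pi),
                (r ^ 2 - 2 * r * Real.cos θ + 1) ^ γ) ∧
          (∫ θ in (0 : ℝ)..(2 * Real.pi),
                (r ^ 2 - 2 * r * Real.cos θ + 1) ^ γ) ≤
            C * (r - 1) ^ (2 * γ + 1)) := by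
  rcases hγ.lt_or_gt with h | h
  · set K : ℝ := 1 + (2 / Real.pi ^ 2) ^ γ / -(2 * γ + 1)
    refine ⟨2 * 4 ^ γ, max (2 * 4 ^ γ) (2 * K), 3 / 2, by positivity, le_max_left _ _,
      by norm_num, by norm_num, fun r hr hr₂ ↦ ⟨fun h' ↦ (lt_asymm h h').elim, fun _ ↦ ?_⟩⟩
    have hε : 0 ≤ (r - 1) ^ (2 * γ + 1) := Real.rpow_nonneg (sub_pos.2 hr).le _
    rw [integral_circle_weight_eq_two_mul γ hr]
    refine ⟨?_, ?_⟩
    · linarith [mul_rpow_le_integral_circle_weight (γ := γ) (by linarith) hr hr₂]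
    · have hK : _ ≤ K * _ := integral_circle_weight_le_mul_rpow h hr hr₂
      refine le_trans ?_ (mul_le_mul_of_nonneg_right (le_max_right _ _) hε)
      linarith
  · obtain ⟨K, hK⟩ := exists_integral_circle_weight_le h
    set m : ℝ := Real.pi / 2 * min 1 (9 ^ γ)
    have hm : 0 < m := by positivity
    refine ⟨2 * m, max (2 * m) (2 * K), 3 / 2, by positivity, le_max_left _ _,
      by norm_num, by norm_num, fun r hr hr₂ ↦ ⟨fun _ ↦ ?_, fun h' ↦ (lt_asymm h h').elim⟩⟩
    rw [integral_circle_weight_eq_two_mul γ hr]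
    refine ⟨?_, le_max_of_le_right ?_⟩
    · have hlow : m ≤ _ := min_mul_le_integral_circle_weight γ hr hr₂
      linarith
    · linarith [hK r hr hr₂]
end

section
/- Fix κ > 0, t ≤ (4+κ)²/(8κ), and set γ = γ(t,κ) = (4+κ − √((4+κ)² − 8tκ))/(2κ) and β = t − (4+κ)γ/2. Let η > 0 and let g : [0, 4+η] → ℝ be positive, twice continuously differentiable, and satisfy κ·x·(x−4)·g″(x) + (8 − 2x + κ(x−2) + 2γκ(x−4))·g′(x) + γ(2+κ)·g(x) = 0 for all x ∈ (0, 4+η). For δ ∈ ℝ define F(r,θ) = (r−1)^β · (r² − 2r·cos θ + 1)^γ · g(r² − 2r·cos θ + 1) · (−log(r−1))^δ. Then there exists r₁ > 1 with (r₁+1)² ≤ 4+η and r₁ < 2 such that for all r ∈ (1, r₁) and all θ ∈ (0, 2π): if δ < 0 then (ΛF)(r,θ) > 0, and if δ > 0 then (ΛF)(r,θ) < 0. -/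
/-- The drift operator `Λ` of radial SLE_κ, acting on functions
`h(r,θ)` of the modulus `r > 1` and the argument `θ`. -/
noncomputable def sleDriftOp (t κ : ℝ) (h : ℝ → ℝ → ℝ) (r θ : ℝ) : ℝ :=
  t * ((r ^ 4 + 4 * r ^ 2 * (1 - r * Real.cos θ) - 1) /
        (r ^ 2 - 2 * r * Real.cos θ + 1) ^ 2 - 1) * h r θ
    + (r * (r ^ 2 - 1) / (r ^ 2 - 2 * r * Real.cos θ + 1)) *
        deriv (fun r' => h r' θ) r
    - (2 * r * Real.sin θ / (r ^ 2 - 2 * r * Real.cos θ + 1)) *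
        deriv (fun θ' => h r θ') θ
    + (κ / 2) * deriv (deriv (fun θ' => h r θ')) θ

/-- The quantity `r² − 2r cos θ + 1 = |re^{iθ} − 1|²` lies between `(r − 1)²` and `(r + 1)²`. -/
lemma sq_dist_one_mem_Ioo {r R θ : ℝ} (hr : 1 < r) (hR : (r + 1) ^ 2 < R) :
    r ^ 2 - 2 * r * Real.cos θ + 1 ∈ Set.Ioo 0 R := by
  have h₁ := Real.cos_le_one θ
  have h₂ := Real.neg_one_le_cos θ
  constructor <;> nlinarith [mul_nonneg (by linarith : (0 : ℝ) ≤ r) (sub_nonneg.2 h₁)]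

lemma hasDerivAt_sq_dist_one_angle (r θ : ℝ) :
    HasDerivAt (fun θ' => r ^ 2 - 2 * r * Real.cos θ' + 1) (2 * r * Real.sin θ) θ := by
  have h := (((Real.hasDerivAt_cos θ).const_mul (2 * r)).const_sub (r ^ 2)).add_const 1
  exact h.congr_deriv (by ring)

lemma hasDerivAt_sq_dist_one_radius (r θ : ℝ) :
    HasDerivAt (fun r' => r' ^ 2 - 2 * r' * Real.cos θ + 1) (2 * r - 2 * Real.cos θ) r := by
  have h := (((hasDerivAt_id r).pow 2).sub
    (((hasDerivAt_id r).const_mul 2).mul_const (Real.cos θ))).add_const 1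
  exact h.congr_deriv (by simp)

/-- The drift operator on a product `a(r) G(r² − 2r cos θ + 1)`. -/
lemma sleDriftOp_mul_comp (t κ : ℝ) {R r : ℝ} (θ : ℝ) (hr : 1 < r) (hR : (r + 1) ^ 2 < R)
    {a G G' G'' : ℝ → ℝ} {a' : ℝ} (ha : HasDerivAt a a' r)
    (hG : ∀ x ∈ Set.Ioo 0 R, HasDerivAt G (G' x) x)
    (hG' : ∀ x ∈ Set.Ioo 0 R, HasDerivAt G' (G'' x) x)
    {x : ℝ} (hx : x = r ^ 2 - 2 * r * Real.cos θ + 1) :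
    sleDriftOp t κ (fun r θ => a r * G (r ^ 2 - 2 * r * Real.cos θ + 1)) r θ =
      t * ((r ^ 4 + 4 * r ^ 2 * (1 - r * Real.cos θ) - 1) / x ^ 2 - 1) * (a r * G x)
      + r * (r ^ 2 - 1) / x * (a' * G x + a r * (G' x * (2 * r - 2 * Real.cos θ)))
      - 2 * r * Real.sin θ / x * (a r * (G' x * (2 * r * Real.sin θ)))
      + κ / 2 * (a r * (G'' x * (2 * r * Real.sin θ) * (2 * r * Real.sin θ)
          + G' x * (2 * r * Real.cos θ))) := by
  have hmem : ∀ φ, r ^ 2 - 2 * r * Real.cos φ + 1 ∈ Set.Ioo 0 R :=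
    fun φ => sq_dist_one_mem_Ioo hr hR
  have hrad : HasDerivAt (fun r' => a r' * G (r' ^ 2 - 2 * r' * Real.cos θ + 1))
      (a' * G x + a r * (G' x * (2 * r - 2 * Real.cos θ))) r := by
    subst hx
    exact ha.mul ((hG _ (hmem θ)).comp r (hasDerivAt_sq_dist_one_radius r θ))
  have hang : ∀ φ, HasDerivAt (fun θ' => a r * G (r ^ 2 - 2 * r * Real.cos θ' + 1))
      (a r * (G' (r ^ 2 - 2 * r * Real.cos φ + 1) * (2 * r * Real.sin φ))) φ := fun φ =>
    ((hG _ (hmem φ)).comp φ (hasDerivAt_sq_dist_one_angle r φ)).const_mul (a r)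
  have hang2 : HasDerivAt
      (fun φ => a r * (G' (r ^ 2 - 2 * r * Real.cos φ + 1) * (2 * r * Real.sin φ)))
      (a r * (G'' x * (2 * r * Real.sin θ) * (2 * r * Real.sin θ)
        + G' x * (2 * r * Real.cos θ))) θ := by
    subst hx
    exact (((hG' _ (hmem θ)).comp θ (hasDerivAt_sq_dist_one_angle r θ)).mul
      ((Real.hasDerivAt_sin θ).const_mul (2 * r))).const_mul (a r)
  have hderiv : deriv (fun θ' => a r * G (r ^ 2 - 2 * r * Real.cos θ' + 1)) =
      fun φ => a r * (G' (r ^ 2 - 2 * r * Real.cos φ + 1) * (2 * r * Real.sin φ)) :=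
    funext fun φ => (hang φ).deriv
  simp only [sleDriftOp, hderiv, hang2.deriv, hrad.deriv, ← hx]

/-- The remainder of the drift operator, divided by `r − 1`, at `u = r − 1` and
`x = r² − 2r cos θ + 1`. -/
noncomputable def sleDriftRemainder (κ t γ β : ℝ) (g g' g'' : ℝ → ℝ) (u x : ℝ) : ℝ :=
  g x * (2 * t * (u + 2) + β * (3 + u) - (u + 2) * γ
      + κ / 2 * (2 * (u + 2) * γ * (γ - 1) + (u + 2) * γ))
    + g' x * ((u + 2) * (2 * (u * (u + 2)) - x
      + κ / 2 * (2 * γ * (2 * x - u * (u + 2)) + x)))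
    + g'' x * (κ / 2 * x * (u + 2) * (2 * x - u * (u + 2)))

/-- A uniform bound for the remainder near the unit circle. -/
lemma exists_abs_sleDriftRemainder_le (κ t γ β : ℝ) {g g' g'' : ℝ → ℝ} {R : ℝ}
    (hg : ContinuousOn g (Set.Icc 0 R)) (hg' : ContinuousOn g' (Set.Icc 0 R))
    (hg'' : ContinuousOn g'' (Set.Icc 0 R)) :
    ∃ C, ∀ u ∈ Set.Icc (0 : ℝ) 1, ∀ x ∈ Set.Icc 0 R,
      |sleDriftRemainder κ t γ β g g' g'' u x| ≤ C := by
  have hsnd : Set.MapsTo Prod.snd (Set.Icc (0 : ℝ) 1 ×ˢ Set.Icc 0 R) (Set.Icc 0 R) :=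
    fun p hp => hp.2
  have h₀ := hg.comp continuousOn_snd hsnd
  have h₁ := hg'.comp continuousOn_snd hsnd
  have h₂ := hg''.comp continuousOn_snd hsnd
  have hcont : ContinuousOn (fun p : ℝ × ℝ => sleDriftRemainder κ t γ β g g' g'' p.1 p.2)
      (Set.Icc (0 : ℝ) 1 ×ˢ Set.Icc 0 R) := by
    unfold sleDriftRemainder
    refine ((h₀.mul ?_).add (h₁.mul ?_)).add (h₂.mul ?_) <;>
      exact Continuous.continuousOn (by fun_prop)
  obtain ⟨C, hC⟩ := (isCompact_Icc.prod isCompact_Icc).exists_bound_of_continuousOn hcont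
  exact ⟨C, fun u hu x hx => hC (u, x) ⟨hu, hx⟩⟩

/-- The leading terms of the drift operator cancel by the quadratic equation for `γ` and the
differential equation for `g`. -/
lemma drift_cancellation {κ t γ β r c s x L g₀ g₁ g₂ : ℝ} (δ : ℝ)
    (hγ : κ * γ ^ 2 - (4 + κ) * γ + 2 * t = 0) (hβ : β = t - (4 + κ) * γ / 2)
    (hcs : s ^ 2 + c ^ 2 = 1) (hx : x = r ^ 2 - 2 * r * c + 1) (hx₀ : x ≠ 0)
    (hr : r - 1 ≠ 0) (hL : L ≠ 0)
    (hode : κ * x * (x - 4) * g₂ + (8 - 2 * x + κ * (x - 2) + 2 * γ * κ * (x - 4)) * g₁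
      + γ * (2 + κ) * g₀ = 0) :
    x * (t * ((r ^ 4 + 4 * r ^ 2 * (1 - r * c) - 1) / x ^ 2 - 1) * g₀
      + r * (r ^ 2 - 1) / x * ((β / (r - 1) - δ / ((r - 1) * L)) * g₀
        + (γ / x * g₀ + g₁) * (2 * r - 2 * c))
      - 2 * r * s / x * ((γ / x * g₀ + g₁) * (2 * r * s))
      + κ / 2 * ((γ * (γ - 1) / x ^ 2 * g₀ + 2 * γ / x * g₁ + g₂) * (2 * r * s) * (2 * r * s)
          + (γ / x * g₀ + g₁) * (2 * r * c))) =
    -(δ * (r * (r + 1)) / L * g₀) + (r - 1) * sleDriftRemainder κ t γ β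
      (fun _ => g₀) (fun _ => g₁) (fun _ => g₂) (r - 1) x := by
  have ht : t = ((4 + κ) * γ - κ * γ ^ 2) / 2 := by linarith
  have hrc : 2 * r * c = r ^ 2 + 1 - x := by linarith
  have hrs : (2 * r * s) * (2 * r * s) = 4 * r ^ 2 - (r ^ 2 + 1 - x) ^ 2 := by
    rw [← hrc]; linear_combination 4 * r ^ 2 * hcs
  have e₁ : r ^ 4 + 4 * r ^ 2 * (1 - r * c) - 1 = 2 * r ^ 2 * x - (r ^ 2 - 1) ^ 2 := by
    linear_combination (-2 * r ^ 2) * hrc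
  have e₂ : r * (r ^ 2 - 1) / x * ((β / (r - 1) - δ / ((r - 1) * L)) * g₀
        + (γ / x * g₀ + g₁) * (2 * r - 2 * c)) =
      (r * (r + 1)) / x * (β - δ / L) * g₀
        + (r ^ 2 - 1) / x * (γ / x * g₀ + g₁) * (r ^ 2 - 1 + x) := by
    have : r ^ 2 - 1 + x = r * (2 * r - 2 * c) := by linarith
    rw [this]; field_simp; ring
  have e₃ : 2 * r * s / x * ((γ / x * g₀ + g₁) * (2 * r * s)) =
      (4 * r ^ 2 - (r ^ 2 + 1 - x) ^ 2) / x * (γ / x * g₀ + g₁) := by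
    rw [← hrs]; ring
  rw [e₁, e₂, e₃, mul_assoc _ (2 * r * s) (2 * r * s), hrs, hrc]
  unfold sleDriftRemainder
  subst hβ
  subst ht
  field_simp
  linear_combination (-x ^ 2 * L) * hode

/-- A remainder of order `r − 1` is dominated by a term of order `1 / L`. -/
lemma abs_mul_lt_leading_term {δ r L m y Q C : ℝ} (hr : 1 < r) (hL : 0 < L) (hm : 0 < m)
    (hmy : m ≤ y) (hQ : |Q| ≤ C) (hC : C * ((r - 1) * L) < |δ| * m) :
    |(r - 1) * Q| < |δ| * (r * (r + 1)) / L * y := by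
  have hu : 0 < r - 1 := by linarith
  have h₁ : |δ| * m ≤ |δ| * (r * (r + 1)) * y := by
    rw [mul_assoc]
    refine mul_le_mul_of_nonneg_left ?_ (abs_nonneg δ)
    exact hmy.trans (le_mul_of_one_le_left (hm.le.trans hmy) (by nlinarith))
  have h₂ := mul_le_mul_of_nonneg_right hQ (mul_pos hu hL).le
  rw [abs_mul, abs_of_pos hu, div_mul_eq_mul_div, lt_div_iff₀ hL]
  linarith

/-- the functions
`F(r,θ) = (r−1)^β (r²−2r cos θ+1)^γ g(r²−2r cos θ+1) (−log(r−1))^δ`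
are strict subsolutions / supersolutions of `ΛF = 0` near the unit circle:
for `r` close enough to `1`, `ΛF > 0` when `δ < 0` and `ΛF < 0` when
`δ > 0`. -/
theorem sle_sub_supersolutions (κ t γ β : ℝ) (hκ : 0 < κ)
    (ht : t ≤ (4 + κ) ^ 2 / (8 * κ))
    (hγ : γ = (4 + κ - Real.sqrt ((4 + κ) ^ 2 - 8 * t * κ)) / (2 * κ))
    (hβ : β = t - (4 + κ) * γ / 2)
    (η : ℝ) (hη : 0 < η)
    (g g' g'' : ℝ → ℝ)
    (hgpos : ∀ x ∈ Set.Icc (0 : ℝ) (4 + η), 0 < g x)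
    (hg' : ∀ x ∈ Set.Icc (0 : ℝ) (4 + η),
      HasDerivWithinAt g (g' x) (Set.Icc 0 (4 + η)) x)
    (hg'' : ∀ x ∈ Set.Icc (0 : ℝ) (4 + η),
      HasDerivWithinAt g' (g'' x) (Set.Icc 0 (4 + η)) x)
    (hg''cont : ContinuousOn g'' (Set.Icc 0 (4 + η)))
    (hode : ∀ x ∈ Set.Ioo (0 : ℝ) (4 + η),
      κ * x * (x - 4) * g'' x
        + (8 - 2 * x + κ * (x - 2) + 2 * γ * κ * (x - 4)) * g' x
        + γ * (2 + κ) * g x = 0)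
    (δ : ℝ) (F : ℝ → ℝ → ℝ)
    (hF : ∀ r θ : ℝ, F r θ =
      (r - 1) ^ β * (r ^ 2 - 2 * r * Real.cos θ + 1) ^ γ *
        g (r ^ 2 - 2 * r * Real.cos θ + 1) * (-Real.log (r - 1)) ^ δ) :
    ∃ r₁ : ℝ, 1 < r₁ ∧ (r₁ + 1) ^ 2 ≤ 4 + η ∧ r₁ < 2 ∧
      ∀ r ∈ Set.Ioo (1 : ℝ) r₁, ∀ θ ∈ Set.Ioo (0 : ℝ) (2 * Real.pi),
        (δ < 0 → 0 < sleDriftOp t κ F r θ) ∧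
        (0 < δ → sleDriftOp t κ F r θ < 0) := by
  have hκ' := hκ.ne'
  have hquad : κ * γ ^ 2 - (4 + κ) * γ + 2 * t = 0 := by
    have hdisc : 0 ≤ (4 + κ) ^ 2 - 8 * t * κ := by
      rw [le_div_iff₀ (by positivity)] at ht
      linarith
    have hsq := Real.sq_sqrt hdisc
    generalize Real.sqrt ((4 + κ) ^ 2 - 8 * t * κ) = q at hγ hsq
    subst hγ
    field_simp
    linear_combination hsq
  have hgc : ContinuousOn g (Set.Icc 0 (4 + η)) := fun x hx => (hg' x hx).continuousWithinAt
  have hgc' : ContinuousOn g' (Set.Icc 0 (4 + η)) := fun x hx => (hg'' x hx).continuousWithinAt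
  obtain ⟨x₀, hx₀, hmin⟩ := isCompact_Icc.exists_isMinOn
    (Set.nonempty_Icc.2 (by linarith : (0 : ℝ) ≤ 4 + η)) hgc
  have hm : 0 < g x₀ := hgpos x₀ hx₀
  obtain ⟨C, hC⟩ := exists_abs_sleDriftRemainder_le κ t γ β hgc hgc' hg''cont
  have hsmall : ∀ᶠ u in nhdsWithin (0 : ℝ) (Set.Ioi 0),
      δ ≠ 0 → C * (u * -Real.log u) < |δ| * g x₀ := by
    by_cases hδ : δ = 0
    · simp [hδ]
    have hlim : Filter.Tendsto (fun u : ℝ => C * (u * -Real.log u))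
        (nhdsWithin 0 (Set.Ioi 0)) (nhds 0) := by
      have h := ((Real.continuous_mul_log.tendsto 0).mono_left
        (nhdsWithin_le_nhds (s := Set.Ioi 0))).neg.const_mul C
      simp only [zero_mul, neg_zero, mul_zero] at h
      exact h.congr fun u => by ring
    filter_upwards [hlim.eventually_lt_const
      (mul_pos (abs_pos.2 hδ) hm)] with u hu _ using hu
  obtain ⟨ε, hε, hεu⟩ := mem_nhdsGT_iff_exists_Ioo_subset.1 hsmall
  have hε : 0 < ε := hε
  have hρ : 0 < min ε (min (1 / 2) (η / 5)) := by positivity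
  have hρε : min ε (min (1 / 2) (η / 5)) ≤ ε := min_le_left _ _
  have hρ₁ : min ε (min (1 / 2) (η / 5)) ≤ 1 / 2 :=
    (min_le_right _ _).trans (min_le_left _ _)
  have hρη : min ε (min (1 / 2) (η / 5)) ≤ η / 5 :=
    (min_le_right _ _).trans (min_le_right _ _)
  generalize min ε (min (1 / 2) (η / 5)) = ρ at hρ hρε hρ₁ hρη
  have hR : (1 + ρ + 1) ^ 2 ≤ 4 + η := by nlinarith
  refine ⟨1 + ρ, by linarith, hR, by linarith, ?_⟩
  rintro r ⟨hr, hrρ⟩ θ -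
  have hu : 0 < r - 1 := by linarith
  have hrR : (r + 1) ^ 2 < 4 + η := by nlinarith
  have hL : 0 < -Real.log (r - 1) := neg_pos.2 (Real.log_neg hu (by linarith))
  have hbound := @hεu (r - 1) ⟨hu, by linarith⟩
  simp only [Set.mem_ofPred_eq] at hbound
  have hLderiv : HasDerivAt (fun r' => -Real.log (r' - 1)) (-(1 / (r - 1))) r :=
    (((hasDerivAt_id r).sub_const 1).log hu.ne').neg
  have ha : HasDerivAt (fun r' => (r' - 1) ^ β * (-Real.log (r' - 1)) ^ δ)
      (((r - 1) ^ β * (-Real.log (r - 1)) ^ δ) *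
        (β / (r - 1) - δ / ((r - 1) * -Real.log (r - 1)))) r := by
    have h := (((hasDerivAt_id r).sub_const 1).rpow_const (p := β) (Or.inl hu.ne')).mul
      (hLderiv.rpow_const (p := δ) (Or.inl hL.ne'))
    refine h.congr_deriv ?_
    simp only [id]
    rw [Real.rpow_sub_one hu.ne', Real.rpow_sub_one hL.ne']
    generalize (-Real.log (r - 1)) ^ δ = b
    generalize -Real.log (r - 1) = l at hL
    have := hL.ne'
    field_simp
    ring
  have hnhds : ∀ x ∈ Set.Ioo (0 : ℝ) (4 + η), Set.Icc 0 (4 + η) ∈ nhds x :=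
    fun x hx => Icc_mem_nhds hx.1 hx.2
  have hG : ∀ x ∈ Set.Ioo (0 : ℝ) (4 + η), HasDerivAt (fun x => x ^ γ * g x)
      (γ * x ^ (γ - 1) * g x + x ^ γ * g' x) x := fun x hx =>
    (Real.hasDerivAt_rpow_const (Or.inl hx.1.ne')).mul
      ((hg' x (Set.Ioo_subset_Icc_self hx)).hasDerivAt (hnhds x hx))
  have hG' : ∀ x ∈ Set.Ioo (0 : ℝ) (4 + η),
      HasDerivAt (fun x => γ * x ^ (γ - 1) * g x + x ^ γ * g' x)
      ((γ * ((γ - 1) * x ^ (γ - 1 - 1)) * g x + γ * x ^ (γ - 1) * g' x)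
        + (γ * x ^ (γ - 1) * g' x + x ^ γ * g'' x)) x := fun x hx =>
    (((Real.hasDerivAt_rpow_const (Or.inl hx.1.ne')).const_mul γ).mul
      ((hg' x (Set.Ioo_subset_Icc_self hx)).hasDerivAt (hnhds x hx))).add
    ((Real.hasDerivAt_rpow_const (Or.inl hx.1.ne')).mul
      ((hg'' x (Set.Ioo_subset_Icc_self hx)).hasDerivAt (hnhds x hx)))
  have hFeq : F = fun r θ => ((r - 1) ^ β * (-Real.log (r - 1)) ^ δ) *
      (fun x => x ^ γ * g x) (r ^ 2 - 2 * r * Real.cos θ + 1) := by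
    funext r θ
    rw [hF]
    ring
  obtain ⟨x, hx⟩ : ∃ x, x = r ^ 2 - 2 * r * Real.cos θ + 1 := ⟨_, rfl⟩
  have hxmem : x ∈ Set.Ioo 0 (4 + η) := hx ▸ sq_dist_one_mem_Ioo hr hrR
  have hformula := sleDriftOp_mul_comp t κ θ hr hrR ha hG hG' hx
  rw [← hFeq] at hformula
  have hcancel := drift_cancellation δ hquad hβ (Real.sin_sq_add_cos_sq θ) hx hxmem.1.ne'
    hu.ne' hL.ne' (hode x hxmem)
  have hQ := hC (r - 1) ⟨hu.le, by linarith⟩ x (Set.Ioo_subset_Icc_self hxmem)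
  have hfactor : x * sleDriftOp t κ F r θ =
      ((r - 1) ^ β * (-Real.log (r - 1)) ^ δ * x ^ γ) *
      (-(δ * (r * (r + 1)) / (-Real.log (r - 1)) * g x)
        + (r - 1) * sleDriftRemainder κ t γ β g g' g'' (r - 1) x) := by
    refine Eq.trans ?_ (congrArg (((r - 1) ^ β * (-Real.log (r - 1)) ^ δ * x ^ γ) * ·) hcancel)
    rw [hformula, Real.rpow_sub_one hxmem.1.ne' (γ - 1), Real.rpow_sub_one hxmem.1.ne' γ]
    ring
  have hA : 0 < (r - 1) ^ β * (-Real.log (r - 1)) ^ δ * x ^ γ :=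
    mul_pos (mul_pos (Real.rpow_pos_of_pos hu _) (Real.rpow_pos_of_pos hL _))
      (Real.rpow_pos_of_pos hxmem.1 _)
  have hgx : g x₀ ≤ g x := hmin (Set.Ioo_subset_Icc_self hxmem)
  generalize sleDriftRemainder κ t γ β g g' g'' (r - 1) x = Q at hQ hfactor
  constructor
  · intro hδ
    refine (mul_pos_iff_of_pos_left hxmem.1).1 ?_
    rw [hfactor]
    have h := abs_lt.1 (abs_mul_lt_leading_term hr hL hm hgx hQ (hbound hδ.ne))
    rw [abs_of_neg hδ, neg_mul, neg_div, neg_mul] at h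
    exact mul_pos hA (by linarith [h.1])
  · intro hδ
    refine (pos_iff_neg_of_mul_neg ?_).1 hxmem.1
    rw [hfactor]
    have h := abs_lt.1 (abs_mul_lt_leading_term hr hL hm hgx hQ (hbound hδ.ne'))
    rw [abs_of_pos hδ] at h
    exact mul_neg_of_pos_of_neg hA (by linarith [h.2])
end

section
/- Fix κ > 0, t ≤ (4+κ)²/(8κ), and set γ = γ(t,κ) = (4+κ − √((4+κ)² − 8tκ))/(2κ) and β = t − (4+κ)γ/2. Let g : (0,4) → ℝ be twice continuously differentiable and satisfy κ·x·(x−4)·g″(x) + (8 − 2x + κ(x−2) + 2γκ(x−4))·g′(x) + γ(2+κ)·g(x) = 0 on (0,4). Define f(r,θ) = (r−1)^β · (r² − 2r·cos θ + 1)^γ · g(r² − 2r·cos θ + 1) for those r > 1 and θ with r² − 2r·cos θ + 1 ∈ (0,4). Then for every fixed θ ∈ (0, π), (Λf)(r,θ) = o((r−1)^β) as r → 1⁺, i.e. lim_{r→1⁺} (r−1)^{−β}·(Λf)(r,θ) = 0. -/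
open Filter Topology Set

/-- The squared distance from `1` to the point with polar coordinates `(r, θ)`, as a function
of `r`, has derivative `2 r - 2 cos θ`. -/
lemma hasDerivAt_sqDist_radius (r θ : ℝ) :
    HasDerivAt (fun r' : ℝ => r' ^ 2 - 2 * r' * Real.cos θ + 1) (2 * r - 2 * Real.cos θ) r := by
  have h := (((hasDerivAt_id r).pow 2).sub
    (((hasDerivAt_id r).const_mul 2).mul_const (Real.cos θ))).add_const 1
  refine h.congr_deriv ?_
  simp

/-- The squared distance from `1` to the point with polar coordinates `(r, θ)`, as a function
of `θ`, has derivative `2 r sin θ`. -/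
lemma hasDerivAt_sqDist_angle (r θ : ℝ) :
    HasDerivAt (fun θ' : ℝ => r ^ 2 - 2 * r * Real.cos θ' + 1) (2 * r * Real.sin θ) θ := by
  have h := (((Real.hasDerivAt_cos θ).const_mul (2 * r)).const_sub (r ^ 2)).add_const 1
  refine h.congr_deriv ?_
  ring

/-- The normalized drift of `(r - 1) ^ β * u (r² - 2 r cos θ + 1)`, in terms of the derivatives
`u'` and `u''` of `u`. -/
lemma rpow_neg_mul_sleDriftOp {s : Set ℝ} (hs : IsOpen s) {u u' u'' : ℝ → ℝ}
    (hu : ∀ x ∈ s, HasDerivAt u (u' x) x) (hu' : ∀ x ∈ s, HasDerivAt u' (u'' x) x)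
    (t κ β : ℝ) {r θ x : ℝ} (hr : 1 < r) (hx : x = r ^ 2 - 2 * r * Real.cos θ + 1)
    (hxs : x ∈ s) :
    (r - 1) ^ (-β) * sleDriftOp t κ
        (fun r θ => (r - 1) ^ β * u (r ^ 2 - 2 * r * Real.cos θ + 1)) r θ =
      t * ((r ^ 4 + 4 * r ^ 2 * (1 - r * Real.cos θ) - 1) / x ^ 2 - 1) * u x
        + r * (r + 1) / x * (β * u x + (r - 1) * (u' x * (2 * r - 2 * Real.cos θ)))
        - 2 * r * Real.sin θ / x * (u' x * (2 * r * Real.sin θ))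
        + κ / 2 * (u'' x * (2 * r * Real.sin θ) ^ 2 + u' x * (2 * r * Real.cos θ)) := by
  have hr0 : 0 < r - 1 := sub_pos.2 hr
  have hradius : deriv (fun r' => (r' - 1) ^ β * u (r' ^ 2 - 2 * r' * Real.cos θ + 1)) r =
      β * (r - 1) ^ (β - 1) * u x
        + (r - 1) ^ β * (u' x * (2 * r - 2 * Real.cos θ)) := by
    have hpow : HasDerivAt (fun r' : ℝ => (r' - 1) ^ β) (β * (r - 1) ^ (β - 1)) r := by
      simpa using ((hasDerivAt_id r).sub_const 1).rpow_const (p := β) (Or.inl hr0.ne')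
    have hcomp := HasDerivAt.comp r (hx ▸ hu x hxs) (hasDerivAt_sqDist_radius r θ)
    rw [hx]
    exact (hpow.mul hcomp).deriv
  have hangle : ∀ φ, r ^ 2 - 2 * r * Real.cos φ + 1 ∈ s →
      deriv (fun θ' => (r - 1) ^ β * u (r ^ 2 - 2 * r * Real.cos θ' + 1)) φ =
        (r - 1) ^ β * (u' (r ^ 2 - 2 * r * Real.cos φ + 1) * (2 * r * Real.sin φ)) :=
    fun φ hφ => ((HasDerivAt.comp φ (hu _ hφ) (hasDerivAt_sqDist_angle r φ)).const_mul _).deriv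
  have hnear : ∀ᶠ φ in 𝓝 θ, r ^ 2 - 2 * r * Real.cos φ + 1 ∈ s :=
    (hasDerivAt_sqDist_angle r θ).continuousAt.eventually (hs.mem_nhds (hx ▸ hxs :))
  have hangle₂ : deriv (deriv
      (fun θ' => (r - 1) ^ β * u (r ^ 2 - 2 * r * Real.cos θ' + 1))) θ =
        (r - 1) ^ β * (u'' x * (2 * r * Real.sin θ) ^ 2 + u' x * (2 * r * Real.cos θ)) := by
    rw [EventuallyEq.deriv_eq (hnear.mono hangle), hx]
    have hcomp := HasDerivAt.comp θ (hu' _ (hx ▸ hxs)) (hasDerivAt_sqDist_angle r θ)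
    have hsin := (Real.hasDerivAt_sin θ).const_mul (2 * r)
    refine (((hcomp.mul hsin).const_mul ((r - 1) ^ β)).congr_deriv ?_).deriv
    simp only [Function.comp_apply]
    ring
  have hcancel : (r - 1) ^ (-β) * (r - 1) ^ β = 1 := by
    rw [← Real.rpow_add hr0, neg_add_cancel, Real.rpow_zero]
  have hpow : (r - 1) ^ β = (r - 1) ^ (β - 1) * (r - 1) := by
    rw [← Real.rpow_add_one hr0.ne', sub_add_cancel]
  rw [sleDriftOp, hradius, hangle θ (hx ▸ hxs), hangle₂, ← hx]
  generalize (r - 1) ^ (-β) = a at *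
  generalize (r - 1) ^ (β - 1) = b at *
  rw [hpow] at hcancel ⊢
  linear_combination (t * ((r ^ 4 + 4 * r ^ 2 * (1 - r * Real.cos θ) - 1) / x ^ 2 - 1) * u x
        + r * (r + 1) / x * (β * u x + (r - 1) * (u' x * (2 * r - 2 * Real.cos θ)))
        - 2 * r * Real.sin θ / x * (u' x * (2 * r * Real.sin θ))
        + κ / 2 * (u'' x * (2 * r * Real.sin θ) ^ 2 + u' x * (2 * r * Real.cos θ))) * hcancel

/-- The boundary operator at `r = 1`: the normalized drift of
`(r - 1) ^ β * u (r² - 2 r cos θ + 1)` converges, as `r → 1⁺`, to a second order differential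
operator applied to `u` at `2 - 2 cos θ`. -/
lemma tendsto_rpow_neg_mul_sleDriftOp {s : Set ℝ} (hs : IsOpen s) {u u' u'' : ℝ → ℝ}
    (hu : ∀ x ∈ s, HasDerivAt u (u' x) x) (hu' : ∀ x ∈ s, HasDerivAt u' (u'' x) x)
    (hu'' : ContinuousOn u'' s) (t κ β : ℝ) {θ x : ℝ} (hx : x = 2 - 2 * Real.cos θ)
    (hxs : x ∈ s) (hx0 : x ≠ 0) :
    Tendsto (fun r : ℝ => (r - 1) ^ (-β) * sleDriftOp t κ
        (fun r θ => (r - 1) ^ β * u (r ^ 2 - 2 * r * Real.cos θ + 1)) r θ) (𝓝[>] 1)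
      (𝓝 (κ / 2 * x * (4 - x) * u'' x + (κ / 2 * (2 - x) - (4 - x)) * u' x
        + (2 * (t + β) / x - t) * u x)) := by
  have hx1 : (1 : ℝ) ^ 2 - 2 * 1 * Real.cos θ + 1 = x := by rw [hx]; ring
  have hX : ContinuousAt (fun r : ℝ => r ^ 2 - 2 * r * Real.cos θ + 1) 1 :=
    (hasDerivAt_sqDist_radius 1 θ).continuousAt
  have hnear : ∀ᶠ r : ℝ in 𝓝 1, r ^ 2 - 2 * r * Real.cos θ + 1 ∈ s :=
    hX.eventually (hs.mem_nhds (hx1 ▸ hxs :))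
  have hcu : ContinuousAt u ((1 : ℝ) ^ 2 - 2 * 1 * Real.cos θ + 1) :=
    hx1 ▸ (hu x hxs).continuousAt
  have hcu' : ContinuousAt u' ((1 : ℝ) ^ 2 - 2 * 1 * Real.cos θ + 1) :=
    hx1 ▸ (hu' x hxs).continuousAt
  have hcu'' : ContinuousAt u'' ((1 : ℝ) ^ 2 - 2 * 1 * Real.cos θ + 1) :=
    hx1 ▸ hu''.continuousAt (hs.mem_nhds hxs)
  have hne : (1 : ℝ) ^ 2 - 2 * 1 * Real.cos θ + 1 ≠ 0 := by rwa [hx1]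
  have hcont : ContinuousAt (fun r : ℝ =>
      t * ((r ^ 4 + 4 * r ^ 2 * (1 - r * Real.cos θ) - 1)
          / (r ^ 2 - 2 * r * Real.cos θ + 1) ^ 2 - 1) * u (r ^ 2 - 2 * r * Real.cos θ + 1)
        + r * (r + 1) / (r ^ 2 - 2 * r * Real.cos θ + 1)
          * (β * u (r ^ 2 - 2 * r * Real.cos θ + 1)
            + (r - 1) * (u' (r ^ 2 - 2 * r * Real.cos θ + 1) * (2 * r - 2 * Real.cos θ)))
        - 2 * r * Real.sin θ / (r ^ 2 - 2 * r * Real.cos θ + 1)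
          * (u' (r ^ 2 - 2 * r * Real.cos θ + 1) * (2 * r * Real.sin θ))
        + κ / 2 * (u'' (r ^ 2 - 2 * r * Real.cos θ + 1) * (2 * r * Real.sin θ) ^ 2
          + u' (r ^ 2 - 2 * r * Real.cos θ + 1) * (2 * r * Real.cos θ))) 1 := by
    fun_prop (disch := first | assumption | exact pow_ne_zero 2 hne)
  have hlim := hcont.tendsto.mono_left (nhdsWithin_le_nhds (s := Ioi 1))
  rw [hx1] at hlim
  have hcos : Real.cos θ = (2 - x) / 2 := by rw [hx]; ring
  have hsin : Real.sin θ ^ 2 = x * (4 - x) / 4 := by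
    rw [Real.sin_sq, hcos]; ring
  have hval : κ / 2 * x * (4 - x) * u'' x + (κ / 2 * (2 - x) - (4 - x)) * u' x
        + (2 * (t + β) / x - t) * u x =
      t * (((1 : ℝ) ^ 4 + 4 * 1 ^ 2 * (1 - 1 * Real.cos θ) - 1) / x ^ 2 - 1) * u x
        + 1 * (1 + 1) / x * (β * u x + (1 - 1) * (u' x * (2 * 1 - 2 * Real.cos θ)))
        - 2 * 1 * Real.sin θ / x * (u' x * (2 * 1 * Real.sin θ))
        + κ / 2 * (u'' x * (2 * 1 * Real.sin θ) ^ 2 + u' x * (2 * 1 * Real.cos θ)) := by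
    rw [hcos]
    field_simp
    linear_combination x * (8 * u' x - 4 * κ * x * u'' x) * hsin
  rw [hval]
  refine hlim.congr' ?_
  filter_upwards [self_mem_nhdsWithin, nhdsWithin_le_nhds hnear] with r hr hrs
  exact (rpow_neg_mul_sleDriftOp hs hu hu' t κ β hr rfl hrs).symm

/-- The derivative of `x ^ γ * g x` at a positive point. -/
lemma HasDerivAt.rpow_mul_of_pos {g : ℝ → ℝ} {d x : ℝ} (hg : HasDerivAt g d x) (hx : 0 < x)
    (γ : ℝ) : HasDerivAt (fun y => y ^ γ * g y) (γ * x ^ (γ - 1) * g x + x ^ γ * d) x :=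
  (Real.hasDerivAt_rpow_const (Or.inl hx.ne')).mul hg

/-- if `g` solves the boundary ODE on `(0,4)`, then for
`f(r,θ) = (r−1)^β (r²−2r cos θ+1)^γ g(r²−2r cos θ+1)` and each fixed
`θ ∈ (0,π)` one has `(Λf)(r,θ) = o((r−1)^β)` as `r → 1⁺`. -/
theorem sle_drift_little_o (κ t γ β : ℝ) (hκ : 0 < κ)
    (ht : t ≤ (4 + κ) ^ 2 / (8 * κ))
    (hγ : γ = (4 + κ - Real.sqrt ((4 + κ) ^ 2 - 8 * t * κ)) / (2 * κ))
    (hβ : β = t - (4 + κ) * γ / 2)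
    (g g' g'' : ℝ → ℝ)
    (hg' : ∀ x ∈ Set.Ioo (0 : ℝ) 4, HasDerivAt g (g' x) x)
    (hg'' : ∀ x ∈ Set.Ioo (0 : ℝ) 4, HasDerivAt g' (g'' x) x)
    (hg''cont : ContinuousOn g'' (Set.Ioo 0 4))
    (hode : ∀ x ∈ Set.Ioo (0 : ℝ) 4,
      κ * x * (x - 4) * g'' x
        + (8 - 2 * x + κ * (x - 2) + 2 * γ * κ * (x - 4)) * g' x
        + γ * (2 + κ) * g x = 0)
    (f : ℝ → ℝ → ℝ)
    (hf : ∀ r θ : ℝ, f r θ =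
      (r - 1) ^ β * (r ^ 2 - 2 * r * Real.cos θ + 1) ^ γ *
        g (r ^ 2 - 2 * r * Real.cos θ + 1)) :
    ∀ θ ∈ Set.Ioo (0 : ℝ) Real.pi,
      Filter.Tendsto (fun r : ℝ => (r - 1) ^ (-β) * sleDriftOp t κ f r θ)
        (nhdsWithin 1 (Set.Ioi 1)) (nhds 0) := by
  intro θ hθ
  obtain rfl : f = fun r θ => (r - 1) ^ β *
      ((fun x => x ^ γ * g x) (r ^ 2 - 2 * r * Real.cos θ + 1)) := by
    funext r θ
    rw [hf, mul_assoc]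
  have hcos_lt : Real.cos θ < 1 := by
    simpa using Real.cos_lt_cos_of_nonneg_of_le_pi le_rfl hθ.2.le hθ.1
  have hlt_cos : -1 < Real.cos θ := by
    simpa using Real.cos_lt_cos_of_nonneg_of_le_pi hθ.1.le le_rfl hθ.2
  obtain ⟨x, hx⟩ : ∃ x, x = 2 - 2 * Real.cos θ := ⟨_, rfl⟩
  have hxs : x ∈ Ioo (0 : ℝ) 4 := ⟨by linarith, by linarith⟩
  have hx0 : x ≠ 0 := hxs.1.ne'
  have hquad : κ * γ ^ 2 - (4 + κ) * γ + 2 * t = 0 := by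
    have hdisc : 0 ≤ (4 + κ) ^ 2 - 8 * t * κ := by
      rw [le_div_iff₀ (by positivity)] at ht
      linarith
    have hsqrt : Real.sqrt ((4 + κ) ^ 2 - 8 * t * κ) = 4 + κ - 2 * κ * γ := by
      rw [hγ]
      field_simp
      ring
    have hsq := Real.sq_sqrt hdisc
    rw [hsqrt] at hsq
    refine (mul_eq_zero.1 (?_ : 4 * κ * _ = 0)).resolve_left (by positivity)
    linear_combination hsq
  have hu : ∀ y ∈ Ioo (0 : ℝ) 4, HasDerivAt (fun y => y ^ γ * g y)
      (γ * (y ^ (γ - 1) * g y) + y ^ γ * g' y) y := fun y hy =>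
    ((hg' y hy).rpow_mul_of_pos hy.1 γ).congr_deriv (by ring)
  have hu' : ∀ y ∈ Ioo (0 : ℝ) 4, HasDerivAt
      (fun y => γ * (y ^ (γ - 1) * g y) + y ^ γ * g' y)
      (γ * (γ - 1) * y ^ (γ - 1 - 1) * g y + 2 * γ * y ^ (γ - 1) * g' y + y ^ γ * g'' y) y :=
    fun y hy => ((((hg' y hy).rpow_mul_of_pos hy.1 (γ - 1)).const_mul γ).add
      ((hg'' y hy).rpow_mul_of_pos hy.1 γ)).congr_deriv (by ring)
  have hu'' : ContinuousOn (fun y => γ * (γ - 1) * y ^ (γ - 1 - 1) * g y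
      + 2 * γ * y ^ (γ - 1) * g' y + y ^ γ * g'' y) (Ioo 0 4) := by
    have hpow : ∀ p : ℝ, ContinuousOn (fun y : ℝ => y ^ p) (Ioo 0 4) := fun p =>
      continuousOn_id.rpow_const fun y hy => Or.inl hy.1.ne'
    have hgc : ContinuousOn g (Ioo 0 4) := fun y hy => (hg' y hy).continuousAt.continuousWithinAt
    have hgc' : ContinuousOn g' (Ioo 0 4) :=
      fun y hy => (hg'' y hy).continuousAt.continuousWithinAt
    exact (((continuousOn_const.mul (hpow _)).mul hgc).add
      ((continuousOn_const.mul (hpow _)).mul hgc')).add ((hpow _).mul hg''cont)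
  convert tendsto_rpow_neg_mul_sleDriftOp isOpen_Ioo hu hu' hu'' t κ β hx hxs hx0 using 2
  have hpow₁ : x ^ γ = x ^ (γ - 1 - 1) * x * x := by
    rw [← Real.rpow_add_one hx0, ← Real.rpow_add_one hx0]
    ring_nf
  have hpow₂ : x ^ (γ - 1) = x ^ (γ - 1 - 1) * x := by
    rw [← Real.rpow_add_one hx0, sub_add_cancel]
  have hode_x := hode x hxs
  rw [hpow₁, hpow₂, hβ]
  generalize x ^ (γ - 1 - 1) = b
  field_simp
  linear_combination b * x ^ 2 * hode_x + b * x * g x * (x - 4) * hquad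
end

section
/- Fix κ > 0 and define f(α) = α − (4+κ)²·(α−1)²/(8κ·(2α−1)) for α > 1/2. Then for every t ≤ 3(4+κ)²/(32κ), sup_{α > 1/2} (f(α) − t)/α = 1 − 2t + (4+κ)·(4+κ − √((4+κ)² − 8tκ))/(4κ); equivalently, the supremum equals β̃(t) − t + 1 where β̃(t) = −t + (4+κ)·(4+κ − √((4+κ)² − 8tκ))/(4κ). -/
/-- The defect in the duality is a perfect square over a positive quantity. Here `a = 4 + κ` and
`s = √(a² - 8tκ)`. -/
theorem legendre_defect_eq {κ a s t α : ℝ} (hκ : 0 < κ) (hα : 1 / 2 < α)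
    (hs : s ^ 2 = a ^ 2 - 8 * t * κ) :
    (α - a ^ 2 * (α - 1) ^ 2 / (8 * κ * (2 * α - 1)) - t) / α =
      1 - 2 * t + a * (a - s) / (4 * κ) -
        (s * (2 * α - 1) - a * α) ^ 2 / (8 * κ * α * (2 * α - 1)) := by
  have hu : 2 * α - 1 ≠ 0 := by linarith
  have ht : t = (a ^ 2 - s ^ 2) / (8 * κ) := by
    rw [eq_div_iff (by positivity)]
    linarith
  subst ht
  obtain ⟨u, rfl⟩ : ∃ u, α = (u + 1) / 2 := ⟨2 * α - 1, by ring⟩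
  have hu' : 2 * ((u + 1) / 2) - 1 = u := by ring
  rw [hu'] at hu ⊢
  have hu1 : u + 1 ≠ 0 := by linarith
  field_simp
  ring

/-- Legendre-type duality between Duplantier's dimension
spectrum `f(α) = α − (4+κ)²(α−1)²/(8κ(2α−1))` and the analytic part of
the average integral means spectrum: for `t ≤ 3(4+κ)²/(32κ)`,
`sup_{α>1/2} (f(α)−t)/α = 1 − 2t + (4+κ)(4+κ−√((4+κ)²−8tκ))/(4κ)`
`= β̃(t) − t + 1`. -/
theorem legendre_duality (κ : ℝ) (hκ : 0 < κ) (f : ℝ → ℝ)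
    (hf : ∀ α : ℝ, 1 / 2 < α →
      f α = α - (4 + κ) ^ 2 * (α - 1) ^ 2 / (8 * κ * (2 * α - 1)))
    (t : ℝ) (ht : t ≤ 3 * (4 + κ) ^ 2 / (32 * κ)) :
    IsLUB {y : ℝ | ∃ α : ℝ, 1 / 2 < α ∧ y = (f α - t) / α}
      (1 - 2 * t +
        (4 + κ) * (4 + κ - Real.sqrt ((4 + κ) ^ 2 - 8 * t * κ)) / (4 * κ)) := by
  set s := Real.sqrt ((4 + κ) ^ 2 - 8 * t * κ)
  have ht' : 32 * κ * t ≤ 3 * (4 + κ) ^ 2 := by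
    rw [le_div_iff₀ (by positivity)] at ht
    linarith
  have hs : s ^ 2 = (4 + κ) ^ 2 - 8 * t * κ :=
    Real.sq_sqrt (by nlinarith [sq_nonneg (4 + κ)])
  have hs_ge : (4 + κ) / 2 ≤ s := Real.le_sqrt_of_sq_le (by nlinarith)
  have key : ∀ α : ℝ, 1 / 2 < α → (f α - t) / α =
      1 - 2 * t + (4 + κ) * (4 + κ - s) / (4 * κ) -
        (s * (2 * α - 1) - (4 + κ) * α) ^ 2 / (8 * κ * α * (2 * α - 1)) := by
    intro α hα
    rw [hf α hα, legendre_defect_eq hκ hα hs]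
  set v := 1 - 2 * t + (4 + κ) * (4 + κ - s) / (4 * κ)
  refine ⟨?_, fun b hb => ?_⟩
  · rintro y ⟨α, hα, rfl⟩
    rw [key α hα]
    have hu : 0 < 2 * α - 1 := by linarith
    have hα0 : 0 < α := by linarith
    exact sub_le_self _ (by positivity)
  · have bound : ∀ α : ℝ, 1 / 2 < α →
        v - (s * (2 * α - 1) - (4 + κ) * α) ^ 2 / (8 * κ * α * (2 * α - 1)) ≤ b :=
      fun α hα => hb ⟨α, hα, (key α hα).symm⟩
    rcases hs_ge.lt_or_eq with hlt | heq
    · -- The supremum is attained at `α = s / (2s - (4 + κ))`.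
      have hd : 0 < 2 * s - (4 + κ) := by linarith
      have hα : 1 / 2 < s / (2 * s - (4 + κ)) := by
        rw [lt_div_iff₀ hd]
        linarith
      have hzero : s * (2 * (s / (2 * s - (4 + κ))) - 1) -
          (4 + κ) * (s / (2 * s - (4 + κ))) = 0 := by
        linear_combination div_mul_cancel₀ s hd.ne'
      simpa [hzero] using bound _ hα
    · -- The supremum is approached as `α → ∞`.
      by_contra! hlt
      have hε : 0 < v - b := sub_pos.mpr hlt
      set α := 1 + (4 + κ) ^ 2 / (32 * κ * (v - b)) with hα_def
      have hα : 1 < α := lt_add_of_pos_right _ (by positivity)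
      have hu : 1 < 2 * α - 1 := by linarith
      have hsq : (s * (2 * α - 1) - (4 + κ) * α) ^ 2 = (4 + κ) ^ 2 / 4 := by
        rw [← heq]
        ring
      have hb' := bound α (by linarith)
      rw [hsq] at hb'
      have hα_mul : 32 * κ * (v - b) * α = 32 * κ * (v - b) + (4 + κ) ^ 2 := by
        rw [hα_def]
        field_simp
      have hα_lt : α < α * (2 * α - 1) := lt_mul_of_one_lt_right (by linarith) hu
      have hsmall : (4 + κ) ^ 2 / 4 / (8 * κ * α * (2 * α - 1)) < v - b := by
        rw [div_lt_iff₀ (by positivity)]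
        have hp : 0 < κ * (v - b) := by positivity
        nlinarith [mul_lt_mul_of_pos_left hα_lt hp]
      linarith
end

section
/- Fix κ > 0, set μ = (4+κ)²/(4κ), and define t_min = (−1 − 2μ − (1+μ)√(1+2μ))/μ and t_max = (−1 − 2μ + (1+μ)√(1+2μ))/μ. Let β̃(t) = −t + μ·(1 − √(1 − 2t/μ)) for t ≤ μ/2 (equivalently β̃(t) = −t + (4+κ)(4+κ − √((4+κ)² − 8tκ))/(4κ)). Then t_min < t_max < μ/2, and for t₀ ∈ {t_min, t_max}: β̃ is differentiable at t₀ with β̃′(t₀) = 1/√(1 − 2t₀/μ) − 1, and t₀·β̃′(t₀) − β̃(t₀) = 1, i.e. the tangent line to the graph of β̃ at t₀ passes through the point (0, −1). -/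
theorem sqrt_one_sub_two_mul_div_eq {μ t u : ℝ} (hμ : 0 < μ) (hu : 0 ≤ u)
    (ht : t = μ * (1 - u ^ 2) / 2) : Real.sqrt (1 - 2 * t / μ) = u := by
  have h : 1 - 2 * t / μ = u ^ 2 := by
    rw [ht]
    field_simp
    ring
  rw [h, Real.sqrt_sq hu]

theorem hasDerivAt_neg_add_mul_one_sub_sqrt {μ t : ℝ} (hμ : μ ≠ 0) (ht : 0 < 1 - 2 * t / μ) :
    HasDerivAt (fun x : ℝ => -x + μ * (1 - Real.sqrt (1 - 2 * x / μ)))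
      (1 / Real.sqrt (1 - 2 * t / μ) - 1) t := by
  have hlin : HasDerivAt (fun x : ℝ => 1 - 2 * x / μ) (-(2 * 1 / μ)) t :=
    (((hasDerivAt_id t).const_mul 2).div_const μ).const_sub 1
  have hβ := (hasDerivAt_id t).neg.add (((hlin.sqrt ht.ne').const_sub 1).const_mul μ)
  refine hβ.congr_deriv ?_
  have hs : Real.sqrt (1 - 2 * t / μ) ≠ 0 := (Real.sqrt_pos.mpr ht).ne'
  generalize Real.sqrt (1 - 2 * t / μ) = s at hs
  field_simp
  ring

/-- In the coordinate `u = √(1 - 2t/μ)`, the tangent at `t` meets the vertical axis at `-1`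
as soon as `μ u² - 2(μ + 1)u + μ = 0`. -/
theorem tangent_through_minus_one_of_quadratic {μ t u : ℝ} (hμ : 0 < μ) (hu : 0 < u)
    (ht : t = μ * (1 - u ^ 2) / 2) (hq : μ * u ^ 2 - 2 * (μ + 1) * u + μ = 0) :
    t * (1 / Real.sqrt (1 - 2 * t / μ) - 1) -
      (-t + μ * (1 - Real.sqrt (1 - 2 * t / μ))) = 1 := by
  rw [sqrt_one_sub_two_mul_div_eq hμ hu.le ht, ht]
  field_simp
  linear_combination hq

/-- with `μ = (4+κ)²/(4κ)` and
`t_min, t_max = (−1−2μ ∓ (1+μ)√(1+2μ))/μ`, the analytic spectrum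
`β̃(t) = −t + μ(1−√(1−2t/μ))` (equivalently
`β̃(t) = −t + (4+κ)(4+κ−√((4+κ)²−8tκ))/(4κ)`) satisfies
`t_min < t_max < μ/2`, and at `t₀ ∈ {t_min, t_max}` it is differentiable
with `β̃′(t₀) = 1/√(1−2t₀/μ) − 1` and `t₀ β̃′(t₀) − β̃(t₀) = 1`, i.e. the
tangent line at `t₀` passes through `(0,−1)`. -/
theorem spectrum_tangents_through_minus_one (κ : ℝ) (hκ : 0 < κ)
    (μ tmin tmax : ℝ)
    (hμ : μ = (4 + κ) ^ 2 / (4 * κ))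
    (htmin : tmin = (-1 - 2 * μ - (1 + μ) * Real.sqrt (1 + 2 * μ)) / μ)
    (htmax : tmax = (-1 - 2 * μ + (1 + μ) * Real.sqrt (1 + 2 * μ)) / μ)
    (βt : ℝ → ℝ)
    (hβ : ∀ t : ℝ, βt t = -t + μ * (1 - Real.sqrt (1 - 2 * t / μ))) :
    (∀ t : ℝ, βt t =
      -t + (4 + κ) * (4 + κ - Real.sqrt ((4 + κ) ^ 2 - 8 * t * κ)) / (4 * κ)) ∧
    tmin < tmax ∧ tmax < μ / 2 ∧
    ∀ t₀ ∈ ({tmin, tmax} : Set ℝ),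
      HasDerivAt βt (1 / Real.sqrt (1 - 2 * t₀ / μ) - 1) t₀ ∧
      t₀ * (1 / Real.sqrt (1 - 2 * t₀ / μ) - 1) - βt t₀ = 1 := by
  have hμ0 : 0 < μ := by rw [hμ]; positivity
  set s := Real.sqrt (1 + 2 * μ)
  have hs : s ^ 2 = 1 + 2 * μ := Real.sq_sqrt (by positivity)
  have hs0 : 0 < s := Real.sqrt_pos.mpr (by positivity)
  have hsμ : s < μ + 1 := by nlinarith
  have hmin : tmin = μ * (1 - ((μ + 1 + s) / μ) ^ 2) / 2 := by
    rw [htmin]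
    field_simp
    linear_combination hs
  have hmax : tmax = μ * (1 - ((μ + 1 - s) / μ) ^ 2) / 2 := by
    rw [htmax]
    field_simp
    linear_combination hs
  have hupos : 0 < (μ + 1 + s) / μ := by positivity
  have huneg : 0 < (μ + 1 - s) / μ := div_pos (by linarith) hμ0
  have tangent : ∀ {t u : ℝ}, 0 < u → t = μ * (1 - u ^ 2) / 2 →
      μ * u ^ 2 - 2 * (μ + 1) * u + μ = 0 →
      HasDerivAt βt (1 / Real.sqrt (1 - 2 * t / μ) - 1) t ∧
        t * (1 / Real.sqrt (1 - 2 * t / μ) - 1) - βt t = 1 := by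
    intro t u hu ht hq
    have hpos : 0 < 1 - 2 * t / μ :=
      Real.sqrt_pos.mp ((sqrt_one_sub_two_mul_div_eq hμ0 hu.le ht).symm ▸ hu)
    rw [funext hβ]
    exact ⟨hasDerivAt_neg_add_mul_one_sub_sqrt hμ0.ne' hpos,
      tangent_through_minus_one_of_quadratic hμ0 hu ht hq⟩
  refine ⟨fun t => ?_, ?_, ?_, ?_⟩
  · have h : (4 + κ) ^ 2 - 8 * t * κ = (4 + κ) ^ 2 * (1 - 2 * t / μ) := by
      rw [hμ]
      field_simp
      ring
    rw [hβ, h, Real.sqrt_mul (sq_nonneg _), Real.sqrt_sq (by positivity)]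
    generalize Real.sqrt (1 - 2 * t / μ) = r
    rw [hμ]
    ring
  · rw [htmin, htmax]
    gcongr
    nlinarith
  · rw [hmax]
    nlinarith [mul_pos hμ0 (pow_pos huneg 2)]
  · rintro t₀ (rfl | rfl)
    · refine tangent hupos hmin ?_
      field_simp
      linear_combination hs
    · refine tangent huneg hmax ?_
      field_simp
      linear_combination hs
end
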